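/- If T is an m-accretive operator on a complex Hilbert space H with closed range, then T is an EP operator; that is, its Moore-Penrose inverse T† is bounded and T T† = T† T on D(T). -/

import Mathlib

open scoped ComplexInnerProductSpace
noncomputable section

variable {H : Type*} [NormedAddCommGroup H] [InnerProductSpace ℂ H] [CompleteSpace H]

/-- The range of a partially defined operator, as a submodule of `H`. -/
def pRange (T : H →ₗ.[ℂ] H) : Submodule ℂ H := LinearMap.range T.toFun

/-- The kernel of a partially defined operator, as a submodule of `H`. -/
def pKer (T : H →ₗ.[ℂ] H) : Submodule ℂ H := (LinearMap.ker T.toFun).map T.domain.subtype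

/-- An operator `T` is accretive if `Re ⟨T x, x⟩ ≥ 0` for all `x` in its domain. -/
def PAccretive (T : H →ₗ.[ℂ] H) : Prop := ∀ x : T.domain, 0 ≤ (⟪(x : H), T x⟫).re

/-- `T` is m-accretive: accretive, densely defined, closed, and `R(μ + T) = H` for all `μ > 0`. -/
def MAccretive (T : H →ₗ.[ℂ] H) : Prop :=
  PAccretive T ∧ Dense (T.domain : Set H) ∧ IsClosed (T.graph : Set (H × H)) ∧
    ∀ μ : ℝ, 0 < μ → ∀ y : H, ∃ x : T.domain, (μ : ℂ) • (x : H) + T x = y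

/-- `T` is sectorial with vertex `0` and semiangle `ω` (ω-accretive):
`W(T) ⊆ {z : |arg z| ≤ ω}`. -/
def SectorialP (T : H →ₗ.[ℂ] H) (ω : ℝ) : Prop :=
  ∀ x : T.domain, ‖(x : H)‖ = 1 → |(⟪(x : H), T x⟫).arg| ≤ ω

/-- `y` is the orthogonal projection of `x` onto the closure of `M`. -/
def IsProjOnto (M : Submodule ℂ H) (x y : H) : Prop :=
  y ∈ M.topologicalClosure ∧ x - y ∈ Mᗮ

/-- `Td` is the Moore-Penrose inverse of `T`: a closed densely defined operator with
domain `R(T) ⊕ R(T)ᗮ` such that `T Td T = T` on `D(T)`, `Td T Td = Td` on `D(Td)`,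
`T Td = P_{cl R(T)}` on `D(Td)` and `Td T = P_{N(T)ᗮ}` on `D(T)`. -/
structure IsMoorePenroseInverse (T Td : H →ₗ.[ℂ] H) : Prop where
  closed' : IsClosed (Td.graph : Set (H × H))
  dense' : Dense (Td.domain : Set H)
  domain_eq : Td.domain = pRange T ⊔ (pRange T)ᗮ
  tdt : ∀ x : T.domain, ∃ (h1 : T x ∈ Td.domain) (h2 : Td ⟨T x, h1⟩ ∈ T.domain),
    T ⟨Td ⟨T x, h1⟩, h2⟩ = T x
  dtd : ∀ x : Td.domain, ∃ (h1 : Td x ∈ T.domain) (h2 : T ⟨Td x, h1⟩ ∈ Td.domain),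
    Td ⟨T ⟨Td x, h1⟩, h2⟩ = Td x
  proj_range : ∀ x : Td.domain, ∃ h1 : Td x ∈ T.domain,
    IsProjOnto (pRange T) (x : H) (T ⟨Td x, h1⟩)
  proj_ker : ∀ x : T.domain, ∃ h1 : T x ∈ Td.domain,
    IsProjOnto ((pKer T)ᗮ) (x : H) (Td ⟨T x, h1⟩)

/-- A bounded everywhere-defined operator viewed as a partially defined operator. -/
def clmToPMap (S : H →L[ℂ] H) : H →ₗ.[ℂ] H := S.toLinearMap.toPMap ⊤

/-- A partially defined operator is bounded if it is bounded on its domain. -/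
def BoundedPMap (T : H →ₗ.[ℂ] H) : Prop := ∃ C : ℝ, ∀ x : T.domain, ‖T x‖ ≤ C * ‖(x : H)‖

/-- `T Td = Td T` on `D(T)`. -/
def CommutesOnDomain (T Td : H →ₗ.[ℂ] H) : Prop :=
  ∀ x : T.domain, ∃ (h1 : (x : H) ∈ Td.domain) (h2 : Td ⟨(x : H), h1⟩ ∈ T.domain)
    (h3 : T x ∈ Td.domain), T ⟨Td ⟨(x : H), h1⟩, h2⟩ = Td ⟨T x, h3⟩

/-- `T` is an EP operator: its Moore-Penrose inverse is bounded and `T T† = T† T` on `D(T)`. -/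
def IsEPPMap (T : H →ₗ.[ℂ] H) : Prop :=
  ∃ Td : H →ₗ.[ℂ] H, IsMoorePenroseInverse T Td ∧ BoundedPMap Td ∧ CommutesOnDomain T Td

/-- The sum `T + S` of a partially defined operator and a bounded operator, with domain `D(T)`. -/
def addB (T : H →ₗ.[ℂ] H) (S : H →L[ℂ] H) : H →ₗ.[ℂ] H :=
  ⟨T.domain, T.toFun + S.toLinearMap.comp T.domain.subtype⟩

/-- The sum of two partially defined operators, with domain `D(A) ∩ D(B)`. -/
def pAdd (A B : H →ₗ.[ℂ] H) : H →ₗ.[ℂ] H :=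
  ⟨A.domain ⊓ B.domain,
    A.toFun.comp (Submodule.inclusion inf_le_left) +
      B.toFun.comp (Submodule.inclusion inf_le_right)⟩

/-- The difference of two partially defined operators, with domain `D(A) ∩ D(B)`. -/
def pSub (A B : H →ₗ.[ℂ] H) : H →ₗ.[ℂ] H :=
  ⟨A.domain ⊓ B.domain,
    A.toFun.comp (Submodule.inclusion inf_le_left) -
      B.toFun.comp (Submodule.inclusion inf_le_right)⟩

/-- The operator `-A - r` on `D(A)`. -/
def negShift (A : H →ₗ.[ℂ] H) (r : ℝ) : H →ₗ.[ℂ] H :=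
  ⟨A.domain, -A.toFun - (r : ℂ) • A.domain.subtype⟩

/-- The composition `B ∘ A` of a bounded operator with a partially defined one. -/
def compB (B : H →L[ℂ] H) (A : H →ₗ.[ℂ] H) : H →ₗ.[ℂ] H :=
  ⟨A.domain, B.toLinearMap.comp A.toFun⟩

/-- `T2` is the square `T ∘ T` of `T`, with domain `{x ∈ D(T) : T x ∈ D(T)}`. -/
def IsSquareOf (T T2 : H →ₗ.[ℂ] H) : Prop :=
  (∀ x : T2.domain, ∃ (h1 : (x : H) ∈ T.domain) (h2 : T ⟨(x : H), h1⟩ ∈ T.domain),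
      T2 x = T ⟨T ⟨(x : H), h1⟩, h2⟩) ∧
  ∀ x : H, x ∈ T2.domain ↔ ∃ h : x ∈ T.domain, T ⟨x, h⟩ ∈ T.domain

/-- The reduced minimum modulus `γ(T) = inf {‖T x‖ : x ∈ N(T)ᗮ ∩ D(T), ‖x‖ = 1}`. -/
def gammaP (T : H →ₗ.[ℂ] H) : ℝ :=
  sInf {r | ∃ x : T.domain, (x : H) ∈ (pKer T)ᗮ ∧ ‖(x : H)‖ = 1 ∧ r = ‖T x‖}

/-- The spectrum of a partially defined operator: the complement of the set of `μ` for which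
`μ - A` has an everywhere-defined bounded inverse. -/
def pSpectrum (A : H →ₗ.[ℂ] H) : Set ℂ :=
  {μ | ¬ ∃ B : H →L[ℂ] H, (∀ x : A.domain, B (μ • (x : H) - A x) = (x : H)) ∧
        ∀ y : H, ∃ h : B y ∈ A.domain, μ • B y - A ⟨B y, h⟩ = y}

/-- The numerical radius of a partially defined operator. -/
def pNumRad (A : H →ₗ.[ℂ] H) : ℝ :=
  sSup {r | ∃ x : A.domain, ‖(x : H)‖ = 1 ∧ r = ‖⟪(x : H), A x⟫‖}

/-- `B` is an everywhere-defined bounded inverse of the partially defined operator `A`. -/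
def IsBoundedInverseOf (A : H →ₗ.[ℂ] H) (B : H →L[ℂ] H) : Prop :=
  (∀ x : A.domain, B (A x) = (x : H)) ∧ ∀ y : H, ∃ h : B y ∈ A.domain, A ⟨B y, h⟩ = y

/-- The real part `(T + T*)/2` of a bounded operator. -/
def reOp (T : H →L[ℂ] H) : H →L[ℂ] H := (2 : ℂ)⁻¹ • (T + ContinuousLinearMap.adjoint T)

/-- The imaginary part `(T - T*)/(2i)` of a bounded operator. -/
def imOp (T : H →L[ℂ] H) : H →L[ℂ] H :=
  (2 * Complex.I)⁻¹ • (T - ContinuousLinearMap.adjoint T)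

/-- A bounded operator is accretive if `Re ⟨T x, x⟩ ≥ 0` for all `x`. -/
def CAccretive (T : H →L[ℂ] H) : Prop := ∀ x : H, 0 ≤ (⟪x, T x⟫).re

/-- A bounded operator is sectorial with vertex `0` and semiangle `ω` if
`W(T) ⊆ {z : |arg z| ≤ ω}`. -/
def Sectorial (T : H →L[ℂ] H) (ω : ℝ) : Prop :=
  ∀ x : H, ‖x‖ = 1 → |(⟪x, T x⟫).arg| ≤ ω

/-- The numerical radius `w(T) = sup {|⟨T x, x⟩| : ‖x‖ = 1}` of a bounded operator. -/
def numRad (T : H →L[ℂ] H) : ℝ := sSup {r | ∃ x : H, ‖x‖ = 1 ∧ r = ‖⟪x, T x⟫‖}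

omit [CompleteSpace H] in
theorem mem_pKer_iff {T : H →ₗ.[ℂ] H} {x : H} :
    x ∈ pKer T ↔ ∃ h : x ∈ T.domain, T ⟨x, h⟩ = 0 := by
  simp [pKer]

omit [CompleteSpace H] in
theorem apply_mem_pRange (T : H →ₗ.[ℂ] H) (x : T.domain) : T x ∈ pRange T :=
  ⟨x, rfl⟩

/-- A nonnegative real affine function on `ℝ` has vanishing slope. -/
theorem eq_zero_of_forall_nonneg_add_mul {a b : ℝ} (h : ∀ t : ℝ, 0 ≤ a + t * b) : b = 0 := by
  by_contra hb
  have := h (-(a + 1) / b)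
  rw [div_mul_cancel₀ _ hb] at this
  linarith

omit [CompleteSpace H] in
/-- The kernel of an accretive operator is orthogonal to its range. -/
theorem PAccretive.inner_eq_zero {T : H →ₗ.[ℂ] H} (hT : PAccretive T) {n : T.domain}
    (hn : T n = 0) (x : T.domain) : ⟪T x, (n : H)⟫ = 0 := by
  have key (c : ℂ) : ∀ t : ℝ, 0 ≤ (⟪(x : H), T x⟫).re + t * (⟪c • (n : H), T x⟫).re := by
    intro t
    have h := hT (x + ((t : ℂ) * c) • n)
    rw [T.map_add, T.map_smul, hn, smul_zero, add_zero] at h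
    simp only [Submodule.coe_add, Submodule.coe_smul, mul_smul] at h
    rw [inner_add_left, inner_smul_left, Complex.conj_ofReal, Complex.add_re,
      Complex.re_ofReal_mul] at h
    exact h
  have h1 := eq_zero_of_forall_nonneg_add_mul (key 1)
  have h2 := eq_zero_of_forall_nonneg_add_mul (key Complex.I)
  rw [inner_eq_zero_symm]
  rw [one_smul] at h1
  rw [inner_smul_left] at h2
  apply Complex.ext
  · simpa using h1
  · simpa using h2

omit [CompleteSpace H] in
/-- The kernel of an m-accretive operator is the orthogonal complement of its range. -/
theorem MAccretive.pKer_eq {T : H →ₗ.[ℂ] H} (hT : MAccretive T) : pKer T = (pRange T)ᗮ := by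
  ext y
  rw [mem_pKer_iff, Submodule.mem_orthogonal]
  constructor
  · rintro ⟨hy, h0⟩ _ ⟨x, rfl⟩
    exact hT.1.inner_eq_zero h0 x
  · intro hy
    obtain ⟨x, hx⟩ := hT.2.2.2 1 one_pos y
    rw [Complex.ofReal_one, one_smul] at hx
    have h0 : T x = 0 := by
      have h := inner_eq_zero_symm.1 (hy _ (apply_mem_pRange T x))
      rw [← hx, inner_add_left] at h
      have hre := congrArg Complex.re h
      have hsq : (⟪T x, T x⟫).re = ‖T x‖ ^ 2 := inner_self_eq_norm_sq (𝕜 := ℂ) (T x)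
      rw [Complex.add_re, hsq, Complex.zero_re] at hre
      have hacc := hT.1 x
      have : ‖T x‖ ^ 2 = 0 := le_antisymm (by linarith) (sq_nonneg _)
      simpa using this
    rw [h0, add_zero] at hx
    subst hx
    exact ⟨x.2, h0⟩

/-- The orthogonal projection onto the closure of a submodule is unique. -/
theorem IsProjOnto.unique {M : Submodule ℂ H} {x y z : H} (hy : IsProjOnto M x y)
    (hz : IsProjOnto M x z) : y = z := by
  have h1 : y - z ∈ Mᗮᗮ := by
    rw [Submodule.orthogonal_orthogonal_eq_closure]
    exact sub_mem hy.1 hz.1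
  have h2 : y - z ∈ Mᗮ := by
    simpa using sub_mem hz.2 hy.2
  exact sub_eq_zero.1 (inner_self_eq_zero.1 (Submodule.inner_right_of_mem_orthogonal h2 h1))

/-- The orthogonal projection onto the double orthogonal complement of `M` is the orthogonal
projection onto the closure of `M`. -/
theorem isProjOnto_orthogonal_orthogonal_iff {M : Submodule ℂ H} {x y : H} :
    IsProjOnto Mᗮᗮ x y ↔ IsProjOnto M x y := by
  rw [IsProjOnto, IsProjOnto, (Submodule.isClosed_orthogonal Mᗮ).submodule_topologicalClosure_eq,
    Submodule.orthogonal_orthogonal_eq_closure, Submodule.orthogonal_closure]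

/-- The closed graph theorem for everywhere-defined closed operators. -/
theorem boundedPMap_of_isClosed_graph {T : H →ₗ.[ℂ] H} (hT : IsClosed (T.graph : Set (H × H)))
    (hdom : T.domain = ⊤) : BoundedPMap T := by
  let f : H →ₗ[ℂ] H := T.toFun.comp
    (LinearMap.id.codRestrict T.domain fun x => hdom ▸ Submodule.mem_top)
  have hf : f.graph = T.graph := by
    ext ⟨a, b⟩
    rw [LinearMap.mem_graph_iff, LinearPMap.mem_graph_iff]
    constructor
    · intro h
      exact ⟨⟨a, hdom ▸ Submodule.mem_top⟩, rfl, h.symm⟩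
    · rintro ⟨x, rfl, rfl⟩
      rfl
  let g := ContinuousLinearMap.ofIsClosedGraph (g := f) (by rwa [hf])
  exact ⟨‖g‖, fun x => g.le_opNorm x⟩

theorem stmt_6 (T Td : H →ₗ.[ℂ] H) (hT : MAccretive T)
    (hcl : IsClosed ((pRange T : Set H))) (hTd : IsMoorePenroseInverse T Td) :
    BoundedPMap Td ∧ CommutesOnDomain T Td := by
  have hdom : Td.domain = ⊤ := by
    have : CompleteSpace (pRange T) := hcl.completeSpace_coe
    rw [hTd.domain_eq, Submodule.sup_orthogonal_of_hasOrthogonalProjection]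
  refine ⟨boundedPMap_of_isClosed_graph hTd.closed' hdom, fun x => ?_⟩
  have h1 : (x : H) ∈ Td.domain := hdom ▸ Submodule.mem_top
  obtain ⟨h2, hr⟩ := hTd.proj_range ⟨x, h1⟩
  obtain ⟨h3, hk⟩ := hTd.proj_ker x
  rw [hT.pKer_eq, isProjOnto_orthogonal_orthogonal_iff] at hk
  exact ⟨h1, h2, h3, hr.unique hk⟩
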